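/- arXiv:2211.01699 — 2 statements merged into one kernel-verified Lean document; each statement's English description precedes it below -/
import Mathlib

section
/- Let G = (V,E) be a finite non-bipartite simple graph of odd girth 2ρ−1 (ρ ≥ 2 an integer), and let v_p ∈ V be such that G∖v_p is bipartite. Let 𝒞 be the set of all odd cycles of G of length exactly 2ρ−1 (each such cycle contains v_p). For C ∈ 𝒞 define w^C : V → ℝ≥0 by w^C(v_p) = 2/ρ, w^C(v) = 1/ρ for v ∈ C∖{v_p}, and w^C(v) = 0 for v ∉ C. Then for every convex combination w = ∑_{C∈𝒞} λ^C w^C (λ^C ≥ 0, ∑ λ^C = 1): OPT(G,w) = 1, w(v_p) = 2/ρ, OPT(G∖v_p, w) = (ρ−1)/ρ, and hence w(v_p) + OPT(G∖v_p, w) = (1 + 1/ρ) · OPT(G, w). -/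
open Finset

/-- `C` is a vertex cover of `G`. -/
def IsVC {V : Type*} (G : SimpleGraph V) (C : Finset V) : Prop :=
  ∀ ⦃u v : V⦄, G.Adj u v → u ∈ C ∨ v ∈ C

/-- `OPT G w` : minimum weight of a vertex cover of `G`. -/
noncomputable def OPT {V : Type*} [Fintype V] (G : SimpleGraph V) (w : V → ℝ) : ℝ :=
  sInf {t : ℝ | ∃ C : Finset V, IsVC G C ∧ t = ∑ v ∈ C, w v}

/-- `LPval G w` : optimal value of the standard vertex cover LP relaxation. -/
noncomputable def LPval {V : Type*} [Fintype V] (G : SimpleGraph V) (w : V → ℝ) : ℝ :=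
  sInf {t : ℝ | ∃ x : V → ℝ, (∀ v, 0 ≤ x v) ∧ (∀ ⦃u v : V⦄, G.Adj u v → 1 ≤ x u + x v) ∧
    t = ∑ v, w v * x v}

/-- The graph `G ∖ S` (vertices of `S` kept as isolated vertices). -/
def Gdel {V : Type*} (G : SimpleGraph V) (S : Set V) : SimpleGraph V :=
  SimpleGraph.fromRel (fun u v => G.Adj u v ∧ u ∉ S ∧ v ∉ S)

open scoped Classical in
/-- Sum of `y` over the set of edges described by `P`. -/
noncomputable def ysum {V : Type*} [Fintype V] [DecidableEq V]
    (y : Sym2 V → ℝ) (P : Sym2 V → Prop) : ℝ :=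
  ∑ e : Sym2 V, if P e then y e else 0

/-- `y` is a dual certificate for `w` : a feasible dual solution with `y(δ(v)) = w v`. -/
def IsDualCert {V : Type*} [Fintype V] [DecidableEq V] (G : SimpleGraph V)
    (w : V → ℝ) (y : Sym2 V → ℝ) : Prop :=
  (∀ e, 0 ≤ y e) ∧ (∀ e, e ∉ G.edgeSet → y e = 0) ∧
    ∀ v : V, ysum y (fun e => e ∈ G.edgeSet ∧ v ∈ e) = w v

/-- Membership in the polytope `Q^W`. -/
def memQW {V : Type*} [Fintype V] [DecidableEq V] (G : SimpleGraph V) (w : V → ℝ) : Prop :=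
  (∀ v, 0 ≤ w v) ∧ (∑ v, w v) = 2 ∧ ∃ y : Sym2 V → ℝ, IsDualCert G w y

/-- `G` has odd girth `n` : it contains an odd cycle of length `n` and no shorter one. -/
def HasOddGirth {V : Type*} (G : SimpleGraph V) (n : ℕ) : Prop :=
  Odd n ∧ (∃ (v : V) (c : G.Walk v v), c.IsCycle ∧ c.length = n) ∧
    ∀ (v : V) (c : G.Walk v v), c.IsCycle → Odd c.length → n ≤ c.length

/-- The contraction `G / S` of the vertex set `S` to a single new vertex `none`. -/
def contract {V : Type*} (G : SimpleGraph V) (S : Set V) :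
    SimpleGraph (Option {v : V // v ∉ S}) :=
  SimpleGraph.fromRel (fun x y =>
    match x, y with
    | some u, some v => G.Adj u.1 v.1
    | some u, none => ∃ s ∈ S, G.Adj u.1 s
    | none, _ => False)

/-- `I` is an independent set of `G`. -/
def IsIndep {V : Type*} (G : SimpleGraph V) (I : Finset V) : Prop :=
  ∀ ⦃u⦄, u ∈ I → ∀ ⦃v⦄, v ∈ I → ¬ G.Adj u v

/-- The fractional chromatic number of `G`. -/
noncomputable def fracChrom {V : Type*} [Fintype V] [DecidableEq V] (G : SimpleGraph V) : ℝ :=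
  sInf {t : ℝ | ∃ y : Finset V → ℝ, (∀ I, 0 ≤ y I) ∧ (∀ I, ¬ IsIndep G I → y I = 0) ∧
    (∀ v : V, 1 ≤ ∑ I : Finset V, if v ∈ I then y I else 0) ∧ t = ∑ I : Finset V, y I}

theorem gdel_adj {V : Type*} (G : SimpleGraph V) (p u v : V) :
    (Gdel G {p}).Adj u v ↔ G.Adj u v ∧ u ≠ p ∧ v ≠ p := by
  simp only [Gdel, SimpleGraph.fromRel_adj, Set.mem_singleton_iff]
  constructor
  · rintro ⟨_, h | h⟩
    · exact h
    · exact ⟨h.1.symm, h.2.2, h.2.1⟩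
  · intro h
    exact ⟨h.1.ne, Or.inl h⟩

/-- A shortest odd cycle through `p`, as a sequence. -/
structure CycSeq {V : Type*} [DecidableEq V] (G : SimpleGraph V) (p : V) (col : V → Bool) (m : ℕ)
    (C : Finset V) (a : ℕ → V) : Prop where
  h0 : a 0 = p
  hn : a (2 * m + 1) = p
  hadj : ∀ i < 2 * m + 1, G.Adj (a i) (a (i + 1))
  hne : ∀ i, 1 ≤ i → i ≤ 2 * m → a i ≠ p
  hinj : ∀ i j, i < 2 * m → j < 2 * m → a (i + 1) = a (j + 1) → i = j
  hC : C.erase p = (range (2 * m)).image (fun i => a (i + 1))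
  hcol : col (a 1) = true
  hch : ∀ j, Odd j → 3 ≤ j → j ≤ 2 * m → ¬ G.Adj p (a j)

theorem exists_cycSeq {V : Type*} [DecidableEq V] (G : SimpleGraph V) (m : ℕ) (hm : 1 ≤ m)
    (hog : HasOddGirth G (2 * m + 1)) (p : V) (hbip : (Gdel G {p}).Colorable 2) (col : V → Bool)
    (hcol : ∀ u v, G.Adj u v → u ≠ p → v ≠ p → col u ≠ col v)
    (v : V) (c : G.Walk v v) (hc : c.IsCycle) (hl : c.length = 2 * m + 1) :
    ∃ a, CycSeq G p col m c.support.toFinset a := by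
  have hp : p ∈ c.support := by
    by_contra hp
    have ht : ∀ e ∈ c.edges, e ∈ (Gdel G {p}).edgeSet := by
      intro e he
      induction e with
      | _ x y =>
        rw [SimpleGraph.mem_edgeSet, gdel_adj]
        refine ⟨c.adj_of_mem_edges he, ?_, ?_⟩
        · rintro rfl; exact hp (c.fst_mem_support_of_mem_edges he)
        · rintro rfl; exact hp (c.snd_mem_support_of_mem_edges he)
    have := SimpleGraph.two_colorable_iff_forall_loop_even.1 hbip v (c.transfer _ ht)
    rw [SimpleGraph.Walk.length_transfer, hl] at this
    exact absurd this (by simp)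
  -- cycles based at p
  have key : ∀ d : G.Walk p p, d.IsCycle → d.length = 2 * m + 1 →
      d.support.toFinset = c.support.toFinset → col (d.getVert 1) = true →
      CycSeq G p col m c.support.toFinset d.getVert := by
    intro d hd hdl hds hdc
    have hne : ∀ i, 1 ≤ i → i ≤ 2 * m → d.getVert i ≠ p := by
      intro i h1 h2 h
      rcases (hd.getVert_endpoint_iff (i := i) (by omega)).1 h with h | h <;> omega
    refine ⟨by simp, by rw [← hdl]; simp, fun i hi => d.adj_getVert_succ (by omega), hne, ?_, ?_,
      hdc, ?_⟩
    · intro i j hi hj h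
      have := hd.getVert_injOn (x₁ := i + 1) (x₂ := j + 1) ⟨by omega, by omega⟩
        ⟨by omega, by omega⟩ h
      omega
    · rw [← hds]
      ext x
      simp only [mem_erase, List.mem_toFinset, mem_image, mem_range,
        SimpleGraph.Walk.mem_support_iff_exists_getVert]
      constructor
      · rintro ⟨hx, i, rfl, hi⟩
        have h0 : i ≠ 0 := by rintro rfl; simp at hx
        have h1 : i ≠ 2 * m + 1 := by rintro rfl; rw [← hdl] at hx; simp at hx
        exact ⟨i - 1, by omega, by congr 1; omega⟩
      · rintro ⟨i, hi, rfl⟩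
        exact ⟨hne _ (by omega) (by omega), i + 1, rfl, by omega⟩
    · intro j hj h3 hj2 hadj
      have hcyc : (SimpleGraph.Walk.cons hadj (d.drop j)).IsCycle := by
        rw [SimpleGraph.Walk.isCycle_iff_isPath_tail_and_le_length]
        constructor
        · simpa using hd.isPath_drop (n := j) (by omega)
        · rw [SimpleGraph.Walk.length_cons, SimpleGraph.Walk.drop_length, hdl]
          obtain ⟨k, rfl⟩ := hj
          omega
      have hlen : (SimpleGraph.Walk.cons hadj (d.drop j)).length = 2 * m + 1 - j + 1 := by
        rw [SimpleGraph.Walk.length_cons, SimpleGraph.Walk.drop_length, hdl]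
      have := hog.2.2 _ _ hcyc (by
        rw [hlen]; obtain ⟨k, rfl⟩ := hj
        exact ⟨m - k, by omega⟩)
      omega
  set d := c.rotate p hp with hd
  have hdc : d.IsCycle := hc.rotate hp
  have hdl : d.length = 2 * m + 1 := by rw [hd, SimpleGraph.Walk.length_rotate, hl]
  have hds : d.support.toFinset = c.support.toFinset := by
    ext x; simp [hd, SimpleGraph.Walk.mem_support_rotate_iff]
  by_cases h1 : col (d.getVert 1) = true
  · exact ⟨_, key d hdc hdl hds h1⟩
  · refine ⟨_, key d.reverse hdc.reverse (by simpa using hdl) (by simp [hds]) ?_⟩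
    rw [SimpleGraph.Walk.getVert_reverse, hdl, Nat.add_sub_cancel]
    have hne : ∀ i, 1 ≤ i → i ≤ 2 * m → d.getVert i ≠ p := by
      intro i h1 h2 h
      rcases (hdc.getVert_endpoint_iff (i := i) (by omega)).1 h with h | h <;> omega
    have : ∀ k, k < m → col (d.getVert (2 * k + 2)) = true := by
      intro k
      have e : ∀ i, 1 ≤ i → i + 1 ≤ 2 * m → col (d.getVert i) ≠ col (d.getVert (i + 1)) :=
        fun i h1 h2 => hcol _ _ (d.adj_getVert_succ (by omega)) (hne _ h1 (by omega))
          (hne _ (by omega) h2)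
      induction k with
      | zero =>
        intro hk
        have := e 1 le_rfl (by omega)
        grind
      | succ k ih =>
        intro hk
        have a1 := e (2 * k + 2) (by omega) (by omega)
        have a2 := e (2 * k + 3) (by omega) (by omega)
        have := ih (by omega)
        rw [show 2 * (k + 1) + 2 = 2 * k + 3 + 1 by ring]
        grind
    have := this (m - 1) (by omega)
    rwa [show 2 * (m - 1) + 2 = 2 * m by omega] at this

/-- indicator -/
def chi {V : Type*} [DecidableEq V] (S : Finset V) (v : V) : ℝ := if v ∈ S then 1 else 0

/-- the basic weight -/
noncomputable def wC {V : Type*} [DecidableEq V] (ρ : ℕ) (p : V) (C : Finset V) (v : V) : ℝ :=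
  if v = p then 2 / (ρ : ℝ) else if v ∈ C then 1 / (ρ : ℝ) else 0

theorem sum_pairs (g : ℕ → ℝ) (m : ℕ) :
    ∑ i ∈ range (2 * m), g i = ∑ k ∈ range m, (g (2 * k) + g (2 * k + 1)) := by
  induction m with
  | zero => simp
  | succ m ih =>
    rw [show 2 * (m + 1) = 2 * m + 1 + 1 by ring, sum_range_succ, sum_range_succ, ih,
      sum_range_succ]
    ring

theorem weight_eq {V : Type*} [Fintype V] [DecidableEq V] {G : SimpleGraph V} {p : V}
    {col : V → Bool} {m : ℕ} {C : Finset V} {a : ℕ → V} (h : CycSeq G p col m C a) (ρ : ℕ)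
    (S : Finset V) :
    ∑ v ∈ S, wC ρ p C v = 2 / (ρ : ℝ) * chi S p + 1 / (ρ : ℝ) *
      ∑ k ∈ range m, (chi S (a (2 * k + 1)) + chi S (a (2 * k + 2))) := by
  have e1 : ∑ k ∈ range m, (chi S (a (2 * k + 1)) + chi S (a (2 * k + 2)))
      = ∑ v ∈ C.erase p, chi S v := by
    rw [h.hC, sum_image]
    · rw [sum_pairs (fun i => chi S (a (i + 1)))]
    · intro i hi j hj hij
      exact h.hinj i j (by simpa using hi) (by simpa using hj) hij
  have e2 : ∀ v, (if v ∈ S then wC ρ p C v else 0) = 2 / (ρ : ℝ) * (if v = p then chi S v else 0)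
      + 1 / (ρ : ℝ) * (if v ∈ C.erase p then chi S v else 0) := by
    intro v
    unfold wC chi
    by_cases h1 : v ∈ S <;> by_cases h2 : v = p <;> by_cases h3 : v ∈ C <;> simp [h1, h2, h3]
  rw [e1, show ∑ v ∈ S, wC ρ p C v = ∑ v, if v ∈ S then wC ρ p C v else 0 by simp]
  rw [Finset.sum_congr rfl (fun v _ => e2 v), sum_add_distrib, ← mul_sum, ← mul_sum,
    sum_ite_mem, univ_inter]
  simp

theorem chi_nonneg {V : Type*} [DecidableEq V] (S : Finset V) (v : V) : 0 ≤ chi S v := by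
  unfold chi; split_ifs <;> norm_num

theorem chi_edge {V : Type*} [DecidableEq V] {S : Finset V} {u v : V} (h : u ∈ S ∨ v ∈ S) :
    1 ≤ chi S u + chi S v := by
  have := chi_nonneg S u
  have := chi_nonneg S v
  rcases h with h | h
  · have : chi S u = 1 := by simp [chi, h]
    linarith
  · have : chi S v = 1 := by simp [chi, h]
    linarith

section
variable {V : Type*} [Fintype V] [DecidableEq V] {G : SimpleGraph V} {p : V}
    {col : V → Bool} {m : ℕ} {C : Finset V} {a : ℕ → V}

theorem low_del (h : CycSeq G p col m C a) (S : Finset V) (hS : IsVC (Gdel G {p}) S) :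
    (m : ℝ) ≤ ∑ k ∈ range m, (chi S (a (2 * k + 1)) + chi S (a (2 * k + 2))) := by
  have : ∑ k ∈ range m, (1 : ℝ) ≤
      ∑ k ∈ range m, (chi S (a (2 * k + 1)) + chi S (a (2 * k + 2))) := by
    refine sum_le_sum fun k hk => chi_edge (hS ?_)
    have hk := mem_range.1 hk
    rw [gdel_adj]
    exact ⟨h.hadj _ (by omega), h.hne _ (by omega) (by omega), h.hne _ (by omega) (by omega)⟩
  simpa using this

theorem low_G (h : CycSeq G p col m C a) (S : Finset V) (hS : IsVC G S) :
    (m : ℝ) + 1 ≤ 2 * chi S p +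
      ∑ k ∈ range m, (chi S (a (2 * k + 1)) + chi S (a (2 * k + 2))) := by
  by_cases hp : p ∈ S
  · have := low_del h S (fun u v huv => hS ((gdel_adj G p u v).1 huv).1)
    have e : chi S p = 1 := by simp [chi, hp]
    rw [e]; linarith
  · have e : chi S p = 0 := by simp [chi, hp]
    have ind : ∀ j, j ≤ m → (j : ℝ) + chi S (a (2 * j)) ≤
        ∑ k ∈ range j, (chi S (a (2 * k + 1)) + chi S (a (2 * k + 2))) := by
      intro j
      induction j with
      | zero => intro _; simp [h.h0, e]
      | succ j ih =>
        intro hj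
        have i1 := ih (by omega)
        have i2 := chi_edge (hS (h.hadj (2 * j) (by omega)))
        rw [sum_range_succ, show 2 * (j + 1) = 2 * j + 2 by ring]
        push_cast
        linarith
    have i1 := ind m le_rfl
    have i2 := chi_edge (hS (h.hadj (2 * m) (by omega)))
    rw [h.hn, e] at i2
    rw [e]; linarith

theorem CycSeq.colors (h : CycSeq G p col m C a)
    (hcol : ∀ u v, G.Adj u v → u ≠ p → v ≠ p → col u ≠ col v) (k : ℕ) (hk : k < m) :
    col (a (2 * k + 1)) = true ∧ col (a (2 * k + 2)) = false := by
  have e : ∀ i, 1 ≤ i → i + 1 ≤ 2 * m → col (a i) ≠ col (a (i + 1)) :=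
    fun i h1 h2 => hcol _ _ (h.hadj i (by omega)) (h.hne _ h1 (by omega)) (h.hne _ (by omega) h2)
  induction k with
  | zero =>
    have := e 1 le_rfl (by omega)
    have := h.hcol
    grind
  | succ k ih =>
    have i := ih (by omega)
    have a1 := e (2 * k + 2) (by omega) (by omega)
    have a2 := e (2 * k + 3) (by omega) (by omega)
    rw [show 2 * (k + 1) + 1 = 2 * k + 3 by ring, show 2 * (k + 1) + 2 = 2 * k + 3 + 1 by ring]
    grind

theorem up_del (h : CycSeq G p col m C a)
    (hcol : ∀ u v, G.Adj u v → u ≠ p → v ≠ p → col u ≠ col v) (S : Finset V)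
    (hS : ∀ v, v ∈ S ↔ v ≠ p ∧ col v = false) :
    ∑ k ∈ range m, (chi S (a (2 * k + 1)) + chi S (a (2 * k + 2))) = m := by
  have : ∑ k ∈ range m, (chi S (a (2 * k + 1)) + chi S (a (2 * k + 2))) =
      ∑ k ∈ range m, (1 : ℝ) := by
    refine sum_congr rfl fun k hk => ?_
    have hk := mem_range.1 hk
    have c := h.colors hcol k hk
    have n := h.hne (2 * k + 2) (by omega) (by omega)
    simp [chi, hS, c, n]
  simpa using this

theorem up_G (h : CycSeq G p col m C a) (hm : 1 ≤ m)
    (hcol : ∀ u v, G.Adj u v → u ≠ p → v ≠ p → col u ≠ col v) (S : Finset V)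
    (hS : ∀ v, v ∈ S ↔ v ≠ p ∧ (col v = false ∨ G.Adj p v)) :
    ∑ k ∈ range m, (chi S (a (2 * k + 1)) + chi S (a (2 * k + 2))) = m + 1 := by
  have : ∑ k ∈ range m, (chi S (a (2 * k + 1)) + chi S (a (2 * k + 2))) =
      ∑ k ∈ range m, ((1 : ℝ) + if k = 0 then 1 else 0) := by
    refine sum_congr rfl fun k hk => ?_
    have hk := mem_range.1 hk
    have c := h.colors hcol k hk
    have n := h.hne (2 * k + 2) (by omega) (by omega)
    have n' := h.hne (2 * k + 1) (by omega) (by omega)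
    have e2 : chi S (a (2 * k + 2)) = 1 := by simp [chi, hS, c, n]
    rw [e2, add_comm]
    congr 1
    by_cases h0 : k = 0
    · subst h0
      have := h.hadj 0 (by omega)
      rw [h.h0] at this
      simp only [mul_zero, zero_add] at this n' ⊢
      simp [chi, hS, n', this]
    · have := h.hch (2 * k + 1) ⟨k, rfl⟩ (by omega) (by omega)
      simp [chi, hS, this, c, h0]
  rw [this, sum_add_distrib, sum_ite_eq']
  have : 0 < m := hm
  simp [this]

theorem OPT_eq (H : SimpleGraph V) (w : V → ℝ) (t : ℝ) (S : Finset V) (hS : IsVC H S)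
    (hSt : ∑ v ∈ S, w v = t) (hlow : ∀ T, IsVC H T → t ≤ ∑ v ∈ T, w v) : OPT H w = t := by
  apply IsLeast.csInf_eq
  refine ⟨⟨S, hS, hSt.symm⟩, ?_⟩
  rintro x ⟨T, hT, rfl⟩
  exact hlow T hT

end

/-- tightness for a single bipartizing vertex.  For any convex combination of
the basic weight functions of shortest odd cycles, the ratio `1 + 1/ρ` is attained. -/
theorem round_bipartize_one_vertex_tight {V : Type*} [Fintype V] [DecidableEq V]
    (G : SimpleGraph V) (hnb : ¬ G.Colorable 2)
    (ρ : ℕ) (hρ : 2 ≤ ρ) (hog : HasOddGirth G (2 * ρ - 1))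
    (v_p : V) (hbip : (Gdel G {v_p}).Colorable 2)
    (lam : Finset V → ℝ) (hlam0 : ∀ C, 0 ≤ lam C)
    (hsupp : ∀ C : Finset V, lam C ≠ 0 →
      ∃ (v : V) (c : G.Walk v v), c.IsCycle ∧ c.length = 2 * ρ - 1 ∧ C = c.support.toFinset)
    (hlam1 : ∑ C : Finset V, lam C = 1)
    (w : V → ℝ)
    (hw : w = fun v => ∑ C : Finset V,
      lam C * (if v = v_p then 2 / (ρ : ℝ) else if v ∈ C then 1 / (ρ : ℝ) else 0)) :
    OPT G w = 1 ∧ w v_p = 2 / (ρ : ℝ) ∧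
      OPT (Gdel G {v_p}) w = ((ρ : ℝ) - 1) / (ρ : ℝ) ∧
      w v_p + OPT (Gdel G {v_p}) w = (1 + 1 / (ρ : ℝ)) * OPT G w := by

  obtain ⟨m, rfl⟩ : ∃ m, ρ = m + 1 := ⟨ρ - 1, by omega⟩
  have hm : 1 ≤ m := by omega
  rw [show 2 * (m + 1) - 1 = 2 * m + 1 by omega] at hog
  simp only [show 2 * (m + 1) - 1 = 2 * m + 1 by omega] at hsupp
  obtain ⟨f⟩ := hbip
  let col : V → Bool := fun v => decide (f v = 0)
  have hcol : ∀ u v, G.Adj u v → u ≠ v_p → v ≠ v_p → col u ≠ col v := by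
    intro u v h hu hv
    have := f.valid ((gdel_adj G v_p u v).2 ⟨h, hu, hv⟩)
    simp only [col]
    intro e
    rw [decide_eq_decide] at e
    apply this
    generalize f u = x at *
    generalize f v = y at *
    revert e
    revert x y
    decide
  have hseq : ∀ C, lam C ≠ 0 → ∃ a, CycSeq G v_p col m C a := by
    intro C hC
    obtain ⟨v, c, hc, hl, rfl⟩ := hsupp C hC
    exact exists_cycSeq G m hm hog v_p ⟨f⟩ col hcol v c hc hl
  have hpos : (0 : ℝ) < ((m + 1 : ℕ) : ℝ) := by positivity
  have hcast : ((m + 1 : ℕ) : ℝ) = (m : ℝ) + 1 := by push_cast; rfl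
  have hsum : ∀ S : Finset V, ∑ v ∈ S, w v = ∑ C, lam C * ∑ v ∈ S, wC (m + 1) v_p C v := by
    intro S
    rw [hw, sum_comm]
    refine sum_congr rfl fun C _ => ?_
    rw [mul_sum]
    rfl
  have hlow : ∀ (S : Finset V) (t : ℝ), (∀ C a, CycSeq G v_p col m C a →
      t ≤ ∑ v ∈ S, wC (m + 1) v_p C v) → t ≤ ∑ v ∈ S, w v := by
    intro S t h
    calc t = ∑ C, lam C * t := by rw [← sum_mul, hlam1, one_mul]
      _ ≤ _ := by
        rw [hsum]
        refine sum_le_sum fun C _ => ?_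
        by_cases hC : lam C = 0
        · simp [hC]
        · obtain ⟨a, ha⟩ := hseq C hC
          exact mul_le_mul_of_nonneg_left (h C a ha) (hlam0 C)
  have heq : ∀ (S : Finset V) (t : ℝ), (∀ C a, CycSeq G v_p col m C a →
      ∑ v ∈ S, wC (m + 1) v_p C v = t) → ∑ v ∈ S, w v = t := by
    intro S t h
    calc _ = ∑ C, lam C * t := by
          rw [hsum]
          refine sum_congr rfl fun C _ => ?_
          by_cases hC : lam C = 0
          · simp [hC]
          · obtain ⟨a, ha⟩ := hseq C hC
            rw [h C a ha]
      _ = t := by rw [← sum_mul, hlam1, one_mul]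
  have hwp : w v_p = 2 / ((m + 1 : ℕ) : ℝ) := by
    rw [hw]
    simp only [if_true]
    rw [← sum_mul, hlam1, one_mul]
  have hO1 : OPT G w = 1 := by
    classical
    let S : Finset V := univ.filter fun v => v ≠ v_p ∧ (col v = false ∨ G.Adj v_p v)
    have hS : ∀ v, v ∈ S ↔ v ≠ v_p ∧ (col v = false ∨ G.Adj v_p v) := by intro v; simp [S]
    refine OPT_eq G w 1 S ?_ (heq S 1 ?_) (fun T hT => hlow T 1 ?_)
    · intro u v huv
      rw [hS, hS]
      by_cases hu : u = v_p
      · subst hu; exact Or.inr ⟨huv.ne', Or.inr huv⟩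
      by_cases hv : v = v_p
      · subst hv; exact Or.inl ⟨huv.ne, Or.inr huv.symm⟩
      have := hcol u v huv hu hv
      cases h1 : col u
      · exact Or.inl ⟨hu, Or.inl rfl⟩
      · refine Or.inr ⟨hv, Or.inl ?_⟩
        rw [h1] at this
        cases h2 : col v
        · rfl
        · exact absurd h2.symm this
    · intro C a h
      rw [weight_eq h, up_G h hm hcol S hS, hcast]
      have : chi S v_p = 0 := by simp [chi, hS]
      rw [this, mul_zero, zero_add, one_div, inv_mul_cancel₀]
      positivity
    · intro C a h
      rw [weight_eq h]
      have := low_G h T hT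
      rw [← hcast] at this
      rw [div_mul_eq_mul_div, div_mul_eq_mul_div, ← add_div, le_div_iff₀ hpos]
      linarith
  have hO2 : OPT (Gdel G {v_p}) w = (((m + 1 : ℕ) : ℝ) - 1) / ((m + 1 : ℕ) : ℝ) := by
    let S : Finset V := univ.filter fun v => v ≠ v_p ∧ col v = false
    have hS : ∀ v, v ∈ S ↔ v ≠ v_p ∧ col v = false := by intro v; simp [S]
    refine OPT_eq _ w _ S ?_ (heq S _ ?_) (fun T hT => hlow T _ ?_)
    · intro u v huv
      rw [hS, hS]
      obtain ⟨huv, hu, hv⟩ := (gdel_adj G v_p u v).1 huv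
      have := hcol u v huv hu hv
      cases h1 : col u
      · exact Or.inl ⟨hu, rfl⟩
      · refine Or.inr ⟨hv, ?_⟩
        rw [h1] at this
        cases h2 : col v
        · rfl
        · exact absurd h2.symm this
    · intro C a h
      rw [weight_eq h, up_del h hcol S hS, hcast]
      have : chi S v_p = 0 := by simp [chi, hS]
      rw [this]
      ring
    · intro C a h
      rw [weight_eq h]
      have h1 := low_del h T hT
      have h2 := chi_nonneg T v_p
      rw [div_mul_eq_mul_div, div_mul_eq_mul_div, ← add_div]
      refine div_le_div_of_nonneg_right ?_ hpos.le
      rw [hcast]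
      linarith
  refine ⟨hO1, hwp, hO2, ?_⟩
  rw [hO1, hwp, hO2]
  field_simp
  ring
end

section
/- Let G = (V,E) be a finite simple graph and S ⊆ V such that G∖S is bipartite and the contraction G/S is bipartite. Let w : V → ℝ≥0 with w(V) = 2 admit a dual certificate y, and set α := y(E[S]), where E[S] is the set of edges of G with both endpoints in S. Then w(S) + OPT(G∖S, w) ≤ (1 + α) · OPT(G, w). -/
open Finset

open scoped Classical in
theorem aux_sum {V : Type*} [Fintype V] [DecidableEq V] (G : SimpleGraph V)
    (w : V → ℝ) (y : Sym2 V → ℝ) (hdc : IsDualCert G w y) (C : Finset V) :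
    ∑ v ∈ C, w v = ∑ e : Sym2 V, y e * ∑ v ∈ C, (if v ∈ e then (1:ℝ) else 0) := by
  simp_rw [Finset.mul_sum]
  rw [Finset.sum_comm]
  refine Finset.sum_congr rfl fun v _ => ?_
  rw [← hdc.2.2 v, ysum]
  refine Finset.sum_congr rfl fun e _ => ?_
  by_cases he : e ∈ G.edgeSet
  · simp [he]
  · simp [he, hdc.2.1 e he]

open scoped Classical in
theorem aux_count {V : Type*} [DecidableEq V] (C : Finset V) (a b : V) (hab : a ≠ b) :
    ∑ v ∈ C, (if v ∈ s(a, b) then (1:ℝ) else 0) =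
      (if a ∈ C then 1 else 0) + (if b ∈ C then 1 else 0) := by
  have h : ∀ v, (if v ∈ s(a, b) then (1:ℝ) else 0) =
      (if v = a then 1 else 0) + (if v = b then 1 else 0) := by
    intro v
    by_cases h1 : v = a
    · subst h1; simp [hab]
    · simp [h1]
  simp_rw [h, Finset.sum_add_distrib, Finset.sum_ite_eq']

/-- for an arbitrary bipartizing set `S` with bipartite contraction, the
round-and-bipartize value is at most `(1 + α) · OPT(G,w)`, where `α = y(E[S])`. -/
theorem round_bipartize_arbitrary_set_bipartite_contraction
    {V : Type*} [Fintype V] [DecidableEq V]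
    (G : SimpleGraph V) (S : Finset V)
    (hbip : (Gdel G ↑S).Colorable 2) (hcbip : (contract G ↑S).Colorable 2)
    (w : V → ℝ) (hw0 : ∀ v, 0 ≤ w v) (hw2 : ∑ v, w v = 2)
    (y : Sym2 V → ℝ) (hdc : IsDualCert G w y)
    (α : ℝ)
    (hα : α = ysum y (fun e => e ∈ G.edgeSet ∧ ∃ p ∈ S, ∃ q ∈ S, e = s(p, q))) :
    ∑ v ∈ S, w v + OPT (Gdel G ↑S) w ≤ (1 + α) * OPT G w := by
  classical
  have hy0 := hdc.1
  have hyz := hdc.2.1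
  have htot : ∑ e, y e = 1 := by
    have h := aux_sum G w y hdc Finset.univ
    have h2 : ∑ e : Sym2 V, y e * ∑ v ∈ Finset.univ, (if v ∈ e then (1:ℝ) else 0)
        = ∑ e, y e * 2 := by
      refine Finset.sum_congr rfl fun e _ => ?_
      by_cases he : e ∈ G.edgeSet
      · induction e using Sym2.ind with
        | _ a b =>
          have hab : G.Adj a b := he
          rw [aux_count _ a b hab.ne]; norm_num
      · simp [hyz e he]
    rw [h2, ← Finset.sum_mul, hw2] at h
    linarith
  have hopt : 1 ≤ OPT G w := by
    apply le_csInf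
    · exact ⟨_, Finset.univ, fun u v _ => Or.inl (Finset.mem_univ u), rfl⟩
    · rintro t ⟨C, hC, rfl⟩
      rw [← htot, aux_sum G w y hdc C]
      refine Finset.sum_le_sum fun e _ => ?_
      by_cases he : e ∈ G.edgeSet
      · induction e using Sym2.ind with
        | _ a b =>
          have hab : G.Adj a b := he
          rw [aux_count _ a b hab.ne]
          refine le_mul_of_one_le_right (hy0 _) ?_
          rcases hC hab with h | h <;> simp only [h, if_true] <;> split_ifs <;> norm_num
      · simp [hyz e he]
  have hα0 : 0 ≤ α := by
    rw [hα, ysum]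
    refine Finset.sum_nonneg fun e _ => ?_
    split_ifs
    · exact hy0 e
    · exact le_rfl
  obtain ⟨c⟩ := hcbip
  let A : Finset V := Finset.univ.filter
    (fun v => ∃ h : v ∉ (↑S : Set V), c (some ⟨v, h⟩) = c none)
  have hA : ∀ v, v ∈ A ↔ ∃ h : v ∉ (↑S : Set V), c (some ⟨v, h⟩) = c none := by
    intro v; simp [A]
  have hcol : ∀ a b (ha : a ∉ (↑S : Set V)) (hb : b ∉ (↑S : Set V)), G.Adj a b →
      c (some ⟨a, ha⟩) ≠ c (some ⟨b, hb⟩) := by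
    intro a b ha hb hab
    apply c.valid
    rw [contract, SimpleGraph.fromRel_adj]
    refine ⟨?_, Or.inl hab⟩
    intro h
    simp only [Option.some.injEq, Subtype.mk.injEq] at h
    exact hab.ne h
  have hcolS : ∀ a b (ha : a ∉ (↑S : Set V)), b ∈ S → G.Adj a b →
      c (some ⟨a, ha⟩) ≠ c none := by
    intro a b ha hb hab
    apply c.valid
    rw [contract, SimpleGraph.fromRel_adj]
    exact ⟨by simp, Or.inl ⟨b, hb, hab⟩⟩
  have hdisj : Disjoint S A := by
    rw [Finset.disjoint_left]
    intro v hv hvA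
    obtain ⟨h, _⟩ := (hA v).1 hvA
    exact h hv
  have hle : OPT (Gdel G ↑S) w ≤ ∑ v ∈ A, w v := by
    apply csInf_le
    · refine ⟨0, ?_⟩
      rintro t ⟨C, _, rfl⟩
      exact Finset.sum_nonneg fun v _ => hw0 v
    · refine ⟨A, ?_, rfl⟩
      intro u v huv
      rw [Gdel, SimpleGraph.fromRel_adj] at huv
      have h : G.Adj u v ∧ u ∉ (↑S : Set V) ∧ v ∉ (↑S : Set V) := by
        rcases huv.2 with h | h
        · exact h
        · exact ⟨h.1.symm, h.2.2, h.2.1⟩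
      obtain ⟨h1, h2, h3⟩ := h
      have h4 := hcol u v h2 h3 h1
      by_contra hcon
      rw [not_or, hA, hA] at hcon
      have h5 : c (some ⟨u, h2⟩) ≠ c none := fun h => hcon.1 ⟨h2, h⟩
      have h6 : c (some ⟨v, h3⟩) ≠ c none := fun h => hcon.2 ⟨h3, h⟩
      generalize c (some ⟨u, h2⟩) = x at *
      generalize c (some ⟨v, h3⟩) = z at *
      generalize c none = t at *
      omega
  have hSA : ∑ v ∈ S, w v + ∑ v ∈ A, w v ≤ 1 + α := by
    rw [← htot, ← Finset.sum_union hdisj, aux_sum G w y hdc, hα, ysum,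
      ← Finset.sum_add_distrib]
    refine Finset.sum_le_sum fun e _ => ?_
    by_cases he : e ∈ G.edgeSet
    · induction e using Sym2.ind with
      | _ a b =>
        have hab : G.Adj a b := he
        have hy := hy0 s(a, b)
        rw [aux_count _ a b hab.ne]
        by_cases hS : a ∈ S ∧ b ∈ S
        · have hP : s(a, b) ∈ G.edgeSet ∧ ∃ p ∈ S, ∃ q ∈ S, s(a, b) = s(p, q) :=
            ⟨he, a, hS.1, b, hS.2, rfl⟩
          rw [if_pos hP]
          simp only [Finset.mem_union, hS.1, hS.2, true_or, if_true]
          linarith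
        · have hnot : ¬ (a ∈ S ∪ A ∧ b ∈ S ∪ A) := by
            rintro ⟨h1, h2⟩
            rw [Finset.mem_union, hA] at h1 h2
            rcases h1 with h1 | ⟨h1, h1'⟩ <;> rcases h2 with h2 | ⟨h2, h2'⟩
            · exact hS ⟨h1, h2⟩
            · exact hcolS b a h2 h1 hab.symm h2'
            · exact hcolS a b h1 h2 hab h1'
            · exact hcol a b h1 h2 hab (h1'.trans h2'.symm)
          have h1 : ((if a ∈ S ∪ A then (1:ℝ) else 0) + (if b ∈ S ∪ A then 1 else 0)) ≤ 1 := by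
            by_cases h1 : a ∈ S ∪ A
            · have h2 : b ∉ S ∪ A := fun h => hnot ⟨h1, h⟩
              rw [if_pos h1, if_neg h2]; norm_num
            · rw [if_neg h1]; split_ifs <;> norm_num
          have h2 := mul_le_mul_of_nonneg_left h1 hy
          refine h2.trans ?_
          rw [mul_one]
          refine le_add_of_nonneg_right ?_
          split_ifs
          · exact hy
          · exact le_rfl
    · simp [hyz e he]
  nlinarith
end
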